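/- Let n ≥ 1 be an integer and suppose < is a left-invariant linear order on G_n with 1 < b⁻¹·a. Then it is not the case that 1 < a, 1 < b, 1 < c, and 1 < d all hold (Case 1 is impossible). Similarly, it is not the case that a < 1, b < 1, c < 1, and d < 1 all hold (Case 16 is impossible). -/

import Mathlib

/-- The four generators of the Kanenobu group `G n`. -/
inductive Gen : Type
  | a | b | c | d
  deriving DecidableEq

open FreeGroup in
/-- The four relators of the presentation of `G n`. -/
def kanenobuRels (n : ℕ) : Set (FreeGroup Gen) :=
  { ((of Gen.a)⁻¹ * of Gen.b) ^ (10 * n) * (of Gen.d)⁻¹ * (of Gen.a) ^ 2,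
    ((of Gen.b)⁻¹) ^ 2 * of Gen.c * ((of Gen.b)⁻¹ * of Gen.a) ^ (10 * n),
    ((of Gen.d)⁻¹ * of Gen.c) ^ (10 * n + 3) * (of Gen.c)⁻¹ * of Gen.b * ((of Gen.c)⁻¹) ^ 2,
    (of Gen.d) ^ 2 * (of Gen.a)⁻¹ * of Gen.d * ((of Gen.c)⁻¹ * of Gen.d) ^ (10 * n + 3) }

/-- The group `G n`, fundamental group of the double branched cover of `K_{-10n,10n+3}`. -/
abbrev G (n : ℕ) : Type := PresentedGroup (kanenobuRels n)

/-- The image of the generator `a` in `G n`. -/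
def ga (n : ℕ) : G n := PresentedGroup.of Gen.a
/-- The image of the generator `b` in `G n`. -/
def gb (n : ℕ) : G n := PresentedGroup.of Gen.b
/-- The image of the generator `c` in `G n`. -/
def gc (n : ℕ) : G n := PresentedGroup.of Gen.c
/-- The image of the generator `d` in `G n`. -/
def gd (n : ℕ) : G n := PresentedGroup.of Gen.d

/-- `lt` is a left-invariant linear (strict total) order on the group `G`. -/
def IsLeftInvariantLinearOrder (G : Type*) [Group G] (lt : G → G → Prop) : Prop :=
  IsStrictTotalOrder G lt ∧ ∀ f g h : G, lt g h → lt (f * g) (f * h)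

section Aux

variable {H : Type*} [Group H] [LinearOrder H]

/-- Left-invariance of a linear order. -/
def LInv (H : Type*) [Group H] [LinearOrder H] : Prop :=
  ∀ f g h : H, g < h → f * g < f * h

theorem LInv.le (hL : LInv H) (f : H) {g h : H} (e : g ≤ h) : f * g ≤ f * h := by
  rcases e.lt_or_eq with e | e
  · exact (hL f _ _ e).le
  · rw [e]

theorem LInv.lt_of (hL : LInv H) (f : H) {g h : H} (e : f * g < f * h) : g < h := by
  simpa using hL f⁻¹ _ _ e

theorem LInv.le_of (hL : LInv H) (f : H) {g h : H} (e : f * g ≤ f * h) : g ≤ h := by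
  simpa using hL.le f⁻¹ e

theorem LInv.mul (hL : LInv H) {g h : H} (hg : 1 < g) (hh : 1 < h) : 1 < g * h := by
  have := hL g _ _ hh
  rw [mul_one] at this
  exact hg.trans this

theorem LInv.inv (hL : LInv H) {g : H} (hg : 1 < g) : g⁻¹ < 1 := by
  simpa using hL g⁻¹ _ _ hg

theorem LInv.pow (hL : LInv H) {g : H} (hg : 1 < g) (j : ℕ) : 1 ≤ g ^ j := by
  induction j with
  | zero => simp
  | succ j ih =>
    rw [pow_succ]
    have := hL (g ^ j) _ _ hg
    rw [mul_one] at this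
    exact ih.trans this.le

theorem LInv.powle (hL : LInv H) {g h : H} (e : g * h ≤ h) (j : ℕ) : g ^ j * h ≤ h := by
  induction j with
  | zero => simp
  | succ j ih =>
    rw [pow_succ, mul_assoc]
    exact (hL.le _ e).trans ih

theorem exP (hL : LInv H) {z : H} (hz : 1 < z) (m : ℕ) : ∃ P : H → Prop,
    (∀ g h, g ≤ h → P g → P h) ∧ ¬ P 1 ∧ (∀ g, P (z * g) ↔ P g) ∧
    (∀ g, P (z ^ m * g) ↔ P g) ∧ (∀ g, 1 ≤ g → z * g ≤ g → P g) := by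
  have key : ∀ g, (∀ j : ℕ, z ^ j ≤ z * g) ↔ (∀ j : ℕ, z ^ j ≤ g) := by
    intro g
    constructor
    · intro h j
      have := h (j + 1)
      rw [pow_succ'] at this
      exact hL.le_of _ this
    · intro h j
      have h1 := hL (z ^ j) _ _ hz
      rw [mul_one, ← pow_succ, pow_succ'] at h1
      exact h1.le.trans (hL.le _ (h j))
  refine ⟨fun g => ∀ j : ℕ, z ^ j ≤ g, ?_, ?_, key, ?_, ?_⟩
  · intro g h e hg j
    exact (hg j).trans e
  · intro h
    have := h 1
    rw [pow_one] at this
    exact absurd hz (not_lt.mpr this)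
  · induction m with
    | zero => simp
    | succ m ih =>
      intro g
      rw [pow_succ, mul_assoc, ih]; exact key g
  · intro g h1 h2 j
    have := hL.le (z ^ j) h1
    rw [mul_one] at this
    exact this.trans (hL.powle h2 j)

/-- Case 1, `d ≤ c`. -/
theorem caseA1 (hL : LInv H) {a b c d x y : H} {k m : ℕ}
    (hx : 1 < x) (hc : 1 < c) (hd : 1 < d) (hy : 1 ≤ y)
    (ha : a = b * x) (hcy : c = d * y)
    (h1 : x ^ k = c⁻¹ * b ^ 2) (h2 : x ^ k = d⁻¹ * a ^ 2)
    (h3 : y ^ m = c ^ 2 * b⁻¹ * c) (h4 : y ^ m = d ^ 2 * a⁻¹ * d) : False := by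
  have hyi : y⁻¹ ≤ 1 := by simpa using hL.le y⁻¹ hy
  have hd' : d = c * y⁻¹ := by rw [hcy]; group
  have hc2 : c ^ 2 * x = y⁻¹ * c * y⁻¹ * c * y⁻¹ := by
    have hb : b = c * (y ^ m)⁻¹ * c ^ 2 := by rw [h3]; group
    have ha' : a = d * (y ^ m)⁻¹ * d ^ 2 := by rw [h4]; group
    have : x = b⁻¹ * a := by rw [ha]; group
    rw [this, ha', hb, hd']
    have e : y ^ m * y⁻¹ * (y ^ m)⁻¹ = y⁻¹ := by group
    calc _ = (y ^ m * y⁻¹ * (y ^ m)⁻¹) * (c * y⁻¹) ^ 2 := by group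
      _ = _ := by rw [e]; simp [pow_two, mul_assoc]
  have hlt : c ^ 2 < y⁻¹ * c * y⁻¹ * c := by
    have e1 := hL (c ^ 2) _ _ hx
    rw [mul_one, hc2] at e1
    have e2 := hL.le (y⁻¹ * c * y⁻¹ * c) hyi
    rw [mul_one] at e2
    exact e1.trans_le e2
  have hcb : b⁻¹ * c < 1 := by
    rcases lt_or_ge c (y⁻¹ * c) with h | h
    · have e1 : y * c ≤ c := by simpa using (hL y _ _ h).le
      have e2 := hL.powle e1 m
      have e3 := hL (y ^ m) _ _ hc
      rw [mul_one] at e3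
      have e4 := e3.trans_le e2
      rw [h3] at e4
      have e5 : b⁻¹ * c < c⁻¹ := by
        apply hL.lt_of (c ^ 2)
        calc _ = c ^ 2 * b⁻¹ * c := by group
          _ < c := e4
          _ = _ := by group
      exact e5.trans (hL.inv hc)
    · have e0 := hL.le c h
      have e1 : y * (c * (y⁻¹ * c)) ≤ c * (y⁻¹ * c) := by
        apply hL.le_of y⁻¹
        calc _ = c * (y⁻¹ * c) := by group
          _ ≤ c * c := e0
          _ = c ^ 2 := by simp [pow_two, mul_assoc]
          _ ≤ _ := hlt.le
          _ = _ := by group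
      have e2 := hL.powle e1 m
      have e3 : 1 < c * (y⁻¹ * c) := by
        rw [← mul_assoc, ← hd']; exact hL.mul hd hc
      have e4 := hL (y ^ m) _ _ e3
      rw [mul_one] at e4
      have e5 := e4.trans_le e2
      rw [h3] at e5
      have e6 := e5.trans_le e0
      apply hL.lt_of (c ^ 2)
      calc _ = c ^ 2 * b⁻¹ * c := by group
          _ < c * c := e6
          _ = _ := by simp [pow_two, mul_assoc]
  have hq : b⁻¹ * c = b * (x ^ k)⁻¹ := by rw [h1]; group
  have hyw : x * b * x * (x ^ k)⁻¹ * y = b * (x ^ k)⁻¹ := by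
    have e : y = x ^ k * (x⁻¹ * b⁻¹ * x⁻¹ * b) * (x ^ k)⁻¹ := by
      have e1 : y = d⁻¹ * c := by rw [hcy]; group
      have e2 : c = b ^ 2 * (x ^ k)⁻¹ := by rw [h1]; group
      have e3 : d = a ^ 2 * (x ^ k)⁻¹ := by rw [h2]; group
      rw [e1, e2, e3, ha]; simp [pow_two, mul_assoc]
    rw [e]; group
  have hxq : x * (b⁻¹ * c) ≤ b⁻¹ * c := by
    rw [hq]
    have e1 := hL.le (x * b * x * (x ^ k)⁻¹) hy
    rw [hyw, mul_one] at e1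
    refine le_trans ?_ e1
    have e2 := (hL (x * b * (x ^ k)⁻¹) _ _ hx).le
    calc _ = x * b * (x ^ k)⁻¹ * 1 := by group
      _ ≤ _ := e2
      _ = _ := by group
  have e1 := (hL.powle hxq k).trans_lt hcb
  have e2 : b⁻¹ * c < (x ^ k)⁻¹ := by
    apply hL.lt_of (x ^ k); simpa using e1
  have e3 := hL b _ _ e2
  rw [← hq] at e3
  have e4 : c < 1 := by
    have := e3.trans hcb
    simpa using this
  exact absurd hc (not_lt.mpr e4.le)

/-- Case 1, `c < d`. -/
theorem caseA2 (hL : LInv H) {a b c d x z : H} {k m : ℕ}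
    (hx : 1 < x) (hc : 1 < c) (hb1 : 1 < b) (hd1 : 1 < d) (hz : 1 < z)
    (ha : a = b * x) (hdz : d = c * z)
    (h1 : x ^ (k + 1) = c⁻¹ * b ^ 2) (h2 : x ^ (k + 1) = d⁻¹ * a ^ 2)
    (h3 : z ^ m = c⁻¹ * b * (c ^ 2)⁻¹) (h4 : z ^ m = d⁻¹ * a * (d ^ 2)⁻¹) : False := by
  obtain ⟨P, up, hP1, hPz, hPT, least⟩ := exP hL hz m
  have hbT : b = c * z ^ m * c ^ 2 := by rw [h3]; group
  have haT : a = d * z ^ m * d ^ 2 := by rw [h4]; group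
  have hX1 : x ^ (k + 1) = z ^ m * c ^ 2 * b := by rw [h1, h3]; simp [pow_two, mul_assoc]
  have hX0 : x ^ k = z ^ m * d ^ 2 * b := by
    have : x ^ k = x ^ (k + 1) * x⁻¹ := by group
    rw [this, h2, h4, ha]; simp [pow_two, mul_assoc]
  have hcd : d ^ 2 * b < c ^ 2 * b := by
    have e := hL (x ^ k) _ _ hx
    rw [mul_one, ← pow_succ, hX0, hX1] at e
    apply hL.lt_of (z ^ m)
    simpa only [mul_assoc] using e
  have hPor : P b ∨ P (d * b) := by
    rcases le_or_gt (z * b) b with h | h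
    · exact Or.inl (least _ hb1.le h)
    · right
      apply least _ (hL.mul hd1 hb1).le
      have e1 : z * (d * b) < c * b := by
        apply hL.lt_of c
        calc _ = d ^ 2 * b := by rw [pow_two]; nth_rewrite 2 [hdz]; group
          _ < _ := hcd
          _ = _ := by simp [pow_two, mul_assoc]
      refine (e1.trans ?_).le
      have := hL c _ _ h
      rwa [← mul_assoc, ← hdz] at this
  have hCC : ∃ u, P u ∧ ¬ P (c⁻¹ * u) := by
    by_contra hcon
    push Not at hcon
    have hb : P b := by
      rcases hPor with h | h
      · exact h
      · have := hcon _ h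
        rw [hdz] at this
        rw [← hPz]
        convert this using 1
        group
    have e1 := hcon _ hb
    have e2 : c⁻¹ * b = z ^ m * c ^ 2 := by rw [hbT]; group
    rw [e2, hPT] at e1
    have e3 := hcon _ (hcon _ e1)
    apply hP1
    convert e3 using 1
    group
  obtain ⟨u, hu1, hu2⟩ := hCC
  have hC : ∀ g, P g → P (c * g) := by
    intro g hg
    apply up u _ _ hu1
    by_contra hlt
    push Not at hlt
    apply hu2
    apply up g _ _ hg
    have := (hL c⁻¹ _ _ hlt).le
    simpa using this
  have hD : ∀ g, P g → P (d * g) := by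
    intro g hg
    rw [hdz, mul_assoc]
    exact hC _ ((hPz g).mpr hg)
  have hPk : P (x ^ k) := by
    rw [hX0, mul_assoc, hPT, pow_two, mul_assoc]
    rcases hPor with h | h
    · exact hD _ (hD _ h)
    · exact hD _ h
  have hPx : ∀ g, P g → P (x * g) := by
    intro g hg
    by_contra hn
    have st : ∀ j : ℕ, ¬ P (x ^ j) := by
      intro j
      induction j with
      | zero => simpa using hP1
      | succ j ih =>
        intro hj
        apply hn
        apply up _ _ _ hj
        rw [pow_succ']
        apply hL.le
        by_contra hlt
        push Not at hlt
        exact ih (up _ _ hlt.le hg)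
    exact st k hPk
  -- the conjugation relation
  have hw : z * x ^ (k + 1) = x ^ (k + 1) * (b⁻¹ * x * a) := by
    have e1 : z = c⁻¹ * d := by rw [hdz]; group
    have e2 : c = b ^ 2 * (x ^ (k + 1))⁻¹ := by rw [h1]; group
    have e3 : d = a ^ 2 * (x ^ (k + 1))⁻¹ := by rw [h2]; group
    rw [e1, e2, e3, ha]; simp [pow_two, mul_assoc]
  have hQw : ∀ g, P (x ^ (k + 1) * (a⁻¹ * (x⁻¹ * g))) ↔ P (x ^ (k + 1) * (b⁻¹ * g)) := by
    intro g
    rw [← hPz, ← mul_assoc z, hw]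
    have : x ^ (k + 1) * (b⁻¹ * x * a) * (a⁻¹ * (x⁻¹ * g)) = x ^ (k + 1) * (b⁻¹ * g) := by group
    rw [this]
  have hQab : ∀ g, P (x ^ (k + 1) * (a⁻¹ * g)) → P (x ^ (k + 1) * (b⁻¹ * g)) := by
    intro g hg
    have := hPx _ hg
    convert this using 1
    rw [ha]; group
  have hQb : ∀ g, x ^ (k + 1) * (b⁻¹ * g) = c⁻¹ * b * g := by
    intro g; rw [h1]; group
  by_cases hV : P (x ^ (k + 1) * (b⁻¹ * 1))
  · have st : ∀ j : ℕ, P (x ^ (k + 1) * (b⁻¹ * (x ^ j)⁻¹)) := by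
      intro j
      induction j with
      | zero => simpa using hV
      | succ j ih =>
        have := hQab _ ((hQw _).mpr ih)
        convert this using 1
        rw [pow_succ]; group
    have e1 := st (k + 1)
    rw [hQb] at e1
    have e2 : c⁻¹ * b * (x ^ (k + 1))⁻¹ = c⁻¹ * (b⁻¹ * c) := by rw [h1]; group
    rw [e2] at e1
    have e3 := hC _ e1
    rw [mul_inv_cancel_left] at e3
    apply hP1
    apply up _ _ _ e3
    apply hL.le_of b
    rw [mul_inv_cancel_left, mul_one, hbT, mul_assoc]
    have f1 : 1 ≤ z ^ m * c ^ 2 := by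
      have f2 := hL.le (z ^ m) (hL.pow hc 2)
      rw [mul_one] at f2
      exact (hL.pow hz m).trans f2
    simpa using hL.le c f1
  · have st : ∀ j : ℕ, ¬ P (x ^ (k + 1) * (b⁻¹ * x ^ j)) := by
      intro j
      induction j with
      | zero => simpa using hV
      | succ j ih =>
        intro hj
        apply ih
        apply hQab
        have := (hQw _).mpr hj
        convert this using 1
        rw [pow_succ']; group
    apply st k
    rw [hQb]
    have e2 : c⁻¹ * b * x ^ k = z ^ m * (c * (c * x ^ k)) := by rw [h3]; group
    rw [e2, hPT]
    exact hC _ (hC _ hPk)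

/-- Case 16, after reversing the order. -/
theorem caseB (hL : LInv H) {a b c d x z : H} {k m : ℕ}
    (hx : 1 < x) (hc : 1 < c) (hb1 : 1 < b)
    (hb : b = a * x) (hcz : c = d * z)
    (h1 : x ^ (k + 1) = (b ^ 2)⁻¹ * c) (h2 : x ^ (k + 1) = (a ^ 2)⁻¹ * d)
    (h3 : z ^ m = c ^ 2 * b⁻¹ * c) (h4 : z ^ m = d ^ 2 * a⁻¹ * d) : False := by
  have hbx : b⁻¹ * c = b * x ^ (k + 1) := by rw [h1]; group
  have hbx1 : 1 < b⁻¹ * c := by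
    rw [hbx]
    have := hL.le b (hL.pow hx (k + 1))
    rw [mul_one] at this
    exact hb1.trans_le this
  have hz : 1 < z := by
    by_contra hz
    push Not at hz
    have := hL.powle (g := z) (h := 1) (by simpa using hz) m
    rw [mul_one, h3, mul_assoc, pow_two] at this
    exact absurd (hL.mul (hL.mul hc hc) hbx1) (not_lt.mpr this)
  obtain ⟨P, up, hP1, hPz, hPT, least⟩ := exP hL hz m
  have hnT : ¬ P (z ^ m) := by
    have := hPT 1
    rw [mul_one] at this
    rwa [this]
  have hdc : d⁻¹ = z * c⁻¹ := by rw [hcz]; group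
  have hbi : b⁻¹ = (c ^ 2)⁻¹ * z ^ m * c⁻¹ := by rw [h3]; group
  have hai : a⁻¹ = (d ^ 2)⁻¹ * z ^ m * d⁻¹ := by rw [h4]; group
  have hlt : (d ^ 2)⁻¹ * z ^ m < (c ^ 2)⁻¹ * z ^ m := by
    have e := hL (x ^ k) _ _ hx
    rw [mul_one, ← pow_succ] at e
    have e1 : x ^ k = b⁻¹ * c * c⁻¹ * ((d ^ 2)⁻¹ * z ^ m) := by
      have : x ^ k = x⁻¹ * x ^ (k + 1) := by group
      rw [this, h2, h4, hb]; group
    have e2 : x ^ (k + 1) = b⁻¹ * c * c⁻¹ * ((c ^ 2)⁻¹ * z ^ m) := by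
      rw [h1, h3]; group
    rw [e1, e2] at e
    exact hL.lt_of _ e
  have hc2T : (c ^ 2)⁻¹ * z ^ m = b⁻¹ * c := by rw [h3]; group
  have hc1T : c⁻¹ * z ^ m = c * (b⁻¹ * c) := by rw [h3]; group
  have hPor : P (c⁻¹ * z ^ m) ∨ P ((c ^ 2)⁻¹ * z ^ m) := by
    rcases le_or_gt (z * (c⁻¹ * z ^ m)) (c⁻¹ * z ^ m) with h | h
    · left
      exact least _ (by rw [hc1T]; exact (hL.mul hc hbx1).le) h
    · right
      apply least _ (by rw [hc2T]; exact hbx1.le)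
      have e1 := hL d⁻¹ _ _ h
      refine le_of_lt (lt_trans ?_ hlt)
      calc z * ((c ^ 2)⁻¹ * z ^ m) = d⁻¹ * (c⁻¹ * z ^ m) := by rw [hdc]; group
        _ < d⁻¹ * (z * (c⁻¹ * z ^ m)) := e1
        _ = d⁻¹ * ((z * c⁻¹) * z ^ m) := by group
        _ = _ := by rw [← hdc]; group
  have hD : ∀ g, P g → P (c⁻¹ * g) := by
    intro g hg
    rcases hPor with h | h
    · apply up _ _ _ h
      apply hL.le
      by_contra hh
      push Not at hh
      exact hnT (up _ _ hh.le hg)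
    · by_contra hn
      have hC : ∀ v, P v → P (c * v) := by
        intro v hv
        apply up g _ _ hg
        by_contra hlt
        push Not at hlt
        apply hn
        apply up v _ _ hv
        have := (hL c⁻¹ _ _ hlt).le
        simpa using this
      apply hnT
      have := hC _ (hC _ h)
      convert this using 1
      group
  have hPc2 : P (b⁻¹ * c) := by
    rw [← hc2T]
    rcases hPor with h | h
    · have := hD _ h
      convert this using 1
      group
    · exact h
  have hbD : ∀ g, P (c⁻¹ * g) → P (b⁻¹ * g) := by
    intro g hg
    have := hD _ (hD _ ((hPT _).mpr hg))
    convert this using 1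
    rw [hbi]; group
  have hPk : P (x ^ (k + 1)) := by
    have := hbD _ (hD _ hPc2)
    convert this using 1
    rw [h1]; group
  have hE : ∀ g, P g → P (x * g) := by
    intro g hg
    by_contra hn
    have st : ∀ j : ℕ, ¬ P (x ^ j) := by
      intro j
      induction j with
      | zero => simpa using hP1
      | succ j ih =>
        intro hj
        apply hn
        apply up _ _ _ hj
        rw [pow_succ']
        apply hL.le
        by_contra hlt
        push Not at hlt
        exact ih (up _ _ hlt.le hg)
    exact st _ hPk
  have hw : z * (x ^ (k + 1))⁻¹ = (x ^ (k + 1))⁻¹ * (a⁻¹ * x * b) := by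
    have e1 : z = d⁻¹ * c := by rw [hcz]; group
    have e2 : c = b ^ 2 * x ^ (k + 1) := by rw [h1]; group
    have e3 : d = a ^ 2 * x ^ (k + 1) := by rw [h2]; group
    rw [e1, e2, e3, hb]; simp [pow_two, mul_assoc]
  have hQw : ∀ g, P ((x ^ (k + 1))⁻¹ * (b⁻¹ * (x⁻¹ * g))) ↔ P ((x ^ (k + 1))⁻¹ * (a⁻¹ * g)) := by
    intro g
    rw [← hPz, ← mul_assoc z, hw]
    have : (x ^ (k + 1))⁻¹ * (a⁻¹ * x * b) * (b⁻¹ * (x⁻¹ * g))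
      = (x ^ (k + 1))⁻¹ * (a⁻¹ * g) := by group
    rw [this]
  have hQba : ∀ g, P ((x ^ (k + 1))⁻¹ * (b⁻¹ * g)) → P ((x ^ (k + 1))⁻¹ * (a⁻¹ * g)) := by
    intro g hg
    have := hE _ hg
    convert this using 1
    rw [hb]; group
  have st : ∀ j : ℕ, ¬ P ((x ^ (k + 1))⁻¹ * (a⁻¹ * x ^ j)) := by
    intro j
    induction j with
    | zero =>
      intro h
      have e : (x ^ (k + 1))⁻¹ * (a⁻¹ * x ^ 0) = (z ^ m)⁻¹ * d ^ 2 := by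
        rw [h2, h4]; group
      rw [e, ← hPT, mul_inv_cancel_left] at h
      have hdd : ∀ g, P (d * g) → P g := by
        intro g hg
        have := (hPz _).mpr (hD _ hg)
        rw [← mul_assoc, ← hdc, inv_mul_cancel_left] at this
        exact this
      apply hP1
      apply hdd
      apply hdd
      convert h using 1
      simp [pow_two, mul_assoc]
    | succ j ih =>
      intro hj
      apply ih
      apply hQba
      have := (hQw _).mpr hj
      convert this using 1
      rw [pow_succ']; group
  apply st (k + 1)
  apply hQba
  have e : (x ^ (k + 1))⁻¹ * (b⁻¹ * x ^ (k + 1)) = c⁻¹ * (b⁻¹ * c) := by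
    rw [h1]; group
  rw [e]
  exact hD _ hPc2

end Aux

section Rel

theorem rel1 (n : ℕ) : ((ga n)⁻¹ * gb n) ^ (10 * n) * (gd n)⁻¹ * (ga n) ^ 2 = 1 :=
  PresentedGroup.one_of_mem (rels := kanenobuRels n) (by left; rfl)

theorem rel2 (n : ℕ) : ((gb n)⁻¹) ^ 2 * gc n * ((gb n)⁻¹ * ga n) ^ (10 * n) = 1 :=
  PresentedGroup.one_of_mem (rels := kanenobuRels n) (by right; left; rfl)

theorem rel3 (n : ℕ) : ((gd n)⁻¹ * gc n) ^ (10 * n + 3) * (gc n)⁻¹ * gb n * ((gc n)⁻¹) ^ 2 = 1 :=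
  PresentedGroup.one_of_mem (rels := kanenobuRels n) (by right; right; left; rfl)

theorem rel4 (n : ℕ) : (gd n) ^ 2 * (ga n)⁻¹ * gd n * ((gc n)⁻¹ * gd n) ^ (10 * n + 3) = 1 :=
  PresentedGroup.one_of_mem (rels := kanenobuRels n) (by right; right; right; rfl)

end Rel

section Main

theorem final {H : Type*} [Group H] (a b c d : H) (k m : ℕ)
    (r1 : (a⁻¹ * b) ^ (k + 1) * d⁻¹ * a ^ 2 = 1)
    (r2 : (b⁻¹) ^ 2 * c * (b⁻¹ * a) ^ (k + 1) = 1)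
    (r3 : (d⁻¹ * c) ^ m * c⁻¹ * b * (c⁻¹) ^ 2 = 1)
    (r4 : d ^ 2 * a⁻¹ * d * (c⁻¹ * d) ^ m = 1) :
    (∀ _ : LinearOrder H, LInv H → 1 < b⁻¹ * a → 1 < a → 1 < b → 1 < c → 1 < d → False) ∧
    (∀ _ : LinearOrder H, LInv H → b⁻¹ * a < 1 → 1 < a → 1 < b → 1 < c → 1 < d → False) := by
  have s1 : (a⁻¹ * b) ^ (k + 1) = (a ^ 2)⁻¹ * d := by
    rw [mul_assoc] at r1
    rw [eq_inv_of_mul_eq_one_left r1]; group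
  have s2 : (b⁻¹ * a) ^ (k + 1) = c⁻¹ * b ^ 2 := by
    rw [eq_inv_of_mul_eq_one_right r2]; group
  have s3 : (d⁻¹ * c) ^ m = c ^ 2 * b⁻¹ * c := by
    rw [mul_assoc, mul_assoc] at r3
    rw [eq_inv_of_mul_eq_one_left r3]; group
  have s4 : (c⁻¹ * d) ^ m = d⁻¹ * a * (d ^ 2)⁻¹ := by
    rw [eq_inv_of_mul_eq_one_right r4]; group
  have i1 : (b⁻¹ * a)⁻¹ = a⁻¹ * b := by group
  have i2 : (c⁻¹ * d)⁻¹ = d⁻¹ * c := by group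
  have s1' : (b⁻¹ * a) ^ (k + 1) = d⁻¹ * a ^ 2 := by
    rw [← inv_inj, ← inv_pow, i1, s1]; group
  have s2' : (a⁻¹ * b) ^ (k + 1) = (b ^ 2)⁻¹ * c := by
    rw [← i1, inv_pow, s2]; group
  have s3' : (c⁻¹ * d) ^ m = c⁻¹ * b * (c ^ 2)⁻¹ := by
    rw [← inv_inj, ← inv_pow, i2, s3]; group
  have s4' : (d⁻¹ * c) ^ m = d ^ 2 * a⁻¹ * d := by
    rw [← i2, inv_pow, s4]; group
  constructor
  · intro _ hL hx ha hb hc hd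
    rcases le_or_gt 1 (d⁻¹ * c) with h | h
    · exact caseA1 hL (a := a) (b := b) hx hc hd h (by group) (by group) s2 s1' s3 s4'
    · refine caseA2 hL (a := a) (b := b) (z := c⁻¹ * d) hx hc hb hd ?_
        (by group) (by group) s2 s1' s3' s4
      have := hL (c⁻¹ * d) _ _ h
      rw [← i2] at this
      simpa using this
  · intro _ hL hx ha hb hc hd
    refine caseB hL (a := a) (b := b) (x := a⁻¹ * b) (z := d⁻¹ * c) ?_ hc hb
      (by group) (by group) s2' s1 s3 s4'
    have := hL (a⁻¹ * b) _ _ hx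
    rw [← i1] at this ⊢
    simpa using this

end Main

/-- Cases 1 (all generators positive) and 16 (all generators negative) are impossible. -/
theorem case1_case16_impossible (n : ℕ) (hn : 1 ≤ n) (lt : G n → G n → Prop)
    (hlt : IsLeftInvariantLinearOrder (G n) lt) (hba : lt 1 ((gb n)⁻¹ * ga n)) :
    ¬ (lt 1 (ga n) ∧ lt 1 (gb n) ∧ lt 1 (gc n) ∧ lt 1 (gd n)) ∧ ¬ (lt (ga n) 1 ∧ lt (gb n) 1 ∧ lt (gc n) 1 ∧ lt (gd n) 1) := by
  classical
  obtain ⟨hst, hinv⟩ := hlt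
  obtain ⟨k, hk⟩ : ∃ k, 10 * n = k + 1 := ⟨10 * n - 1, by omega⟩
  have r1 := rel1 n
  have r2 := rel2 n
  have r3 := rel3 n
  have r4 := rel4 n
  rw [hk] at r1 r2
  obtain ⟨F1, F2⟩ := final _ _ _ _ k _ r1 r2 r3 r4
  constructor
  · rintro ⟨ha, hb, hc, hd⟩
    exact F1 (linearOrderOfSTO lt) hinv hba ha hb hc hd
  · rintro ⟨ha, hb, hc, hd⟩
    haveI : IsStrictTotalOrder (G n) (Function.swap lt) := inferInstance
    exact F2 (linearOrderOfSTO (Function.swap lt)) (fun f g h e => hinv f h g e) hba ha hb hc hd
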